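/- arXiv:1903.08079 — 7 statements merged into one kernel-verified Lean document; each statement's English description precedes it below -/
import Mathlib

section
/- Every left R-module M admits a coneat injective envelope e : M → E, and moreover the image e(M) is a coneat submodule of E. In particular, every left R-module embeds as a coneat submodule of a coneat injective module. -/
/-!
Basic notions from the theory of coneat exact sequences.

A short exact sequence `0 → A → B → C → 0` of left `R`-modules is *coneat exact* if for every
simple right `R`-module `S` the induced map `S ⊗[R] A → S ⊗[R] B` is injective.  Since every
simple right `R`-module is isomorphic to `R ⧸ I` for a maximal right ideal `I` (realized below
as a left ideal `I : Ideal Rᵐᵒᵖ`), and since `(R ⧸ I) ⊗[R] B ≅ B ⧸ I•B` (as abelian groups,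
where `I•B` is the additive subgroup generated by the products `i • b`, `i ∈ I`, `b ∈ B`),
this is equivalent to the elementwise condition `A ∩ I•B ⊆ I•A` for every maximal right
ideal `I`, which is the formulation used here (Mathlib has no tensor product of a right module
with a left module over a noncommutative ring).
-/

universe u v

section Defs

variable (R : Type u) [Ring R]

/-- The additive subgroup of a left `R`-module `B` generated by the products `i • n` with
`i` in a right ideal `I` (realized as a left ideal of `Rᵐᵒᵖ`) and `n ∈ N`. -/
def rIdealSMul {B : Type v} [AddCommGroup B] [Module R B] (I : Ideal Rᵐᵒᵖ) (N : Set B) :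
    AddSubgroup B :=
  AddSubgroup.closure {x : B | ∃ i ∈ I, ∃ n ∈ N, x = MulOpposite.unop i • n}

/-- `A` is a *coneat submodule* of `B` : the sequence `0 → A → B → B ⧸ A → 0` remains exact
after tensoring with every simple right `R`-module, i.e. `A ∩ I•B ⊆ I•A` for every maximal
right ideal `I` of `R`. -/
def IsConeatSubmodule {B : Type v} [AddCommGroup B] [Module R B] (A : Submodule R B) : Prop :=
  ∀ I : Ideal Rᵐᵒᵖ, I.IsMaximal → ∀ a : B, a ∈ A →
    a ∈ rIdealSMul R I (Set.univ : Set B) → a ∈ rIdealSMul R I (A : Set B)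

/-- The short exact sequence `0 → A –f→ B –g→ C → 0` is *coneat exact*. -/
def IsConeatExactSeq {A B C : Type v} [AddCommGroup A] [Module R A] [AddCommGroup B] [Module R B]
    [AddCommGroup C] [Module R C] (f : A →ₗ[R] B) (g : B →ₗ[R] C) : Prop :=
  Function.Injective f ∧ Function.Surjective g ∧ Function.Exact f g ∧
    IsConeatSubmodule R (LinearMap.range f)

/-- A left `R`-module `M` is *coneat injective* if for every coneat submodule `A` of a left
`R`-module `B`, every homomorphism `A → M` extends to `B`. -/
def IsConeatInjective (M : Type v) [AddCommGroup M] [Module R M] : Prop :=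
  ∀ (B : ModuleCat.{v} R) (A : Submodule R B), IsConeatSubmodule R A →
    ∀ f : A →ₗ[R] M, ∃ g : B →ₗ[R] M, g.comp A.subtype = f

/-- `e : M → E` is a *coneat injective envelope* of `M` : `e` is injective, `E` is coneat
injective, every homomorphism from `M` to a coneat injective module factors through `e`, and
every endomorphism `f` of `E` with `f ∘ e = e` is an automorphism. -/
def IsConeatInjectiveEnvelope {M E : Type v} [AddCommGroup M] [Module R M] [AddCommGroup E]
    [Module R E] (e : M →ₗ[R] E) : Prop :=
  Function.Injective e ∧ IsConeatInjective R E ∧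
    (∀ (C : ModuleCat.{v} R), IsConeatInjective R C → ∀ g : M →ₗ[R] C,
      ∃ h : E →ₗ[R] C, h.comp e = g) ∧
    (∀ f : E →ₗ[R] E, f.comp e = e → Function.Bijective f)

/-- `M` is *`N`-coneat injective* if every homomorphism from a coneat submodule of `N`
to `M` extends to `N`. -/
def IsRelConeatInjective (M N : Type v) [AddCommGroup M] [Module R M] [AddCommGroup N]
    [Module R N] : Prop :=
  ∀ K : Submodule R N, IsConeatSubmodule R K →
    ∀ f : K →ₗ[R] M, ∃ g : N →ₗ[R] M, g.comp K.subtype = f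

/-- `M` is *quasi coneat injective* if it is `M`-coneat injective. -/
def IsQuasiConeatInjective (M : Type v) [AddCommGroup M] [Module R M] : Prop :=
  IsRelConeatInjective R M M

/-- `M` is *coneat-`N`-injective* if for (some, equivalently every) coneat injective envelope
`e : M → E`, every homomorphism `f : N → E` satisfies `f (N) ⊆ e (M)`. -/
def IsConeatRelInjective (M N : Type v) [AddCommGroup M] [Module R M] [AddCommGroup N]
    [Module R N] : Prop :=
  ∀ (E : ModuleCat.{v} R) (e : M →ₗ[R] E), IsConeatInjectiveEnvelope R e →
    ∀ f : N →ₗ[R] E, ∀ n : N, f n ∈ LinearMap.range e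

/-- `M` is *coneat quasi injective* if it is coneat-`M`-injective, i.e. fully invariant in its
coneat injective envelope. -/
def IsConeatQuasiInjective (M : Type v) [AddCommGroup M] [Module R M] : Prop :=
  IsConeatRelInjective R M M

/-- `A` is a *pure submodule* of `B` : the sequence `0 → A → B → B ⧸ A → 0` remains exact after
tensoring with every right `R`-module; elementwise (Cohn's criterion): every finite system of
linear equations `aᵢ = ∑ⱼ rᵢⱼ • xⱼ` with constants in `A` which is solvable in `B` is solvable
in `A`. -/
def IsPureSubmodule {B : Type v} [AddCommGroup B] [Module R B] (A : Submodule R B) : Prop :=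
  ∀ (m n : ℕ) (r : Fin m → Fin n → R) (a : Fin m → A),
    (∃ b : Fin n → B, ∀ i, (a i : B) = ∑ j, r i j • b j) →
    ∃ a' : Fin n → A, ∀ i, (a i : B) = ∑ j, r i j • (a' j : B)

/-- The short exact sequence `0 → A –f→ B –g→ C → 0` is *pure exact*. -/
def IsPureExactSeq {A B C : Type v} [AddCommGroup A] [Module R A] [AddCommGroup B] [Module R B]
    [AddCommGroup C] [Module R C] (f : A →ₗ[R] B) (g : B →ₗ[R] C) : Prop :=
  Function.Injective f ∧ Function.Surjective g ∧ Function.Exact f g ∧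
    IsPureSubmodule R (LinearMap.range f)

/-- A left `R`-module `M` is *pure injective* if for every pure submodule `A` of a left
`R`-module `B`, every homomorphism `A → M` extends to `B`. -/
def IsPureInjective (M : Type v) [AddCommGroup M] [Module R M] : Prop :=
  ∀ (B : ModuleCat.{v} R) (A : Submodule R B), IsPureSubmodule R A →
    ∀ f : A →ₗ[R] M, ∃ g : B →ₗ[R] M, g.comp A.subtype = f

/-- A right `R`-module `S` (i.e. a left `Rᵐᵒᵖ`-module) is *flat*, expressed through the
equational criterion (which over any ring is equivalent to `S ⊗[R] —` preserving injections):
every relation `∑ᵢ sᵢ aᵢ = 0` in `S` comes from relations in `R`. -/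
def IsFlatRightModule (S : Type v) [AddCommGroup S] [Module Rᵐᵒᵖ S] : Prop :=
  ∀ (m : ℕ) (a : Fin m → R) (s : Fin m → S),
    (∑ i, MulOpposite.op (a i) • s i) = 0 →
    ∃ (n : ℕ) (b : Fin n → Fin m → R) (t : Fin n → S),
      (∀ i, s i = ∑ j, MulOpposite.op (b j i) • t j) ∧ (∀ j, ∑ i, b j i * a i = 0)

/-- A left `R`-module `C` is *coneat flat* if `C ≅ B ⧸ A` for some coneat submodule `A ≤ B`. -/
def IsConeatFlat (C : Type v) [AddCommGroup C] [Module R C] : Prop :=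
  ∃ (B : ModuleCat.{v} R) (A : Submodule R B),
    IsConeatSubmodule R A ∧ Nonempty ((B ⧸ A) ≃ₗ[R] C)

end Defs

section RIdealSMul

variable {R : Type u} [Ring R]

theorem rIdealSMul_image {B C : Type*} [AddCommGroup B] [Module R B] [AddCommGroup C] [Module R C]
    (I : Ideal Rᵐᵒᵖ) (f : B →ₗ[R] C) (N : Set B) :
    rIdealSMul R I (f '' N) = (rIdealSMul R I N).map f.toAddMonoidHom := by
  rw [rIdealSMul, rIdealSMul, AddMonoidHom.map_closure]
  congr 1
  ext x
  constructor
  · rintro ⟨i, hi, _, ⟨n, hn, rfl⟩, rfl⟩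
    exact ⟨_, ⟨i, hi, n, hn, rfl⟩, map_smul f _ _⟩
  · rintro ⟨_, ⟨i, hi, n, hn, rfl⟩, rfl⟩
    exact ⟨i, hi, _, ⟨n, hn, rfl⟩, map_smul f _ _⟩

theorem rIdealSMul_mono {B : Type*} [AddCommGroup B] [Module R B]
    (I : Ideal Rᵐᵒᵖ) {N N' : Set B} (h : N ⊆ N') : rIdealSMul R I N ≤ rIdealSMul R I N' :=
  AddSubgroup.closure_mono fun _ ⟨i, hi, n, hn, hx⟩ ↦ ⟨i, hi, n, h hn, hx⟩

theorem rIdealSMul_le {B : Type*} [AddCommGroup B] [Module R B] (I : Ideal Rᵐᵒᵖ)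
    (N : Submodule R B) : rIdealSMul R I (N : Set B) ≤ N.toAddSubgroup := by
  refine (AddSubgroup.closure_le _).2 ?_
  rintro _ ⟨i, -, n, hn, rfl⟩
  exact N.smul_mem _ hn

theorem map_mem_rIdealSMul {B C : Type*} [AddCommGroup B] [Module R B] [AddCommGroup C]
    [Module R C] {I : Ideal Rᵐᵒᵖ} (f : B →ₗ[R] C) {N : Set B} {N' : Set C}
    (h : Set.MapsTo f N N') {b : B} (hb : b ∈ rIdealSMul R I N) : f b ∈ rIdealSMul R I N' := by
  refine rIdealSMul_mono I h.image_subset ?_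
  rw [rIdealSMul_image]
  exact ⟨b, hb, rfl⟩

theorem eq_zero_of_mem_rIdealSMul_bot {B : Type*} [AddCommGroup B] [Module R B] {N : Set B}
    {b : B} (hb : b ∈ rIdealSMul R (⊥ : Ideal Rᵐᵒᵖ) N) : b = 0 := by
  have h : rIdealSMul R (⊥ : Ideal Rᵐᵒᵖ) N ≤ ⊥ := by
    refine (AddSubgroup.closure_le _).2 ?_
    rintro _ ⟨i, hi, n, -, rfl⟩
    simp [(Submodule.mem_bot _).1 hi]
  exact h hb

theorem exists_mem_rIdealSMul_of_directed {B ι : Type*} [AddCommGroup B] [Module R B] [Nonempty ι]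
    {D : ι → Submodule R B} (hD : Directed (· ≤ ·) D) {I : Ideal Rᵐᵒᵖ} {b : B}
    (hb : b ∈ rIdealSMul R I ((⨆ i, D i : Submodule R B) : Set B)) :
    ∃ i, b ∈ rIdealSMul R I (D i : Set B) := by
  have hdir : Directed (· ≤ ·) fun i ↦ rIdealSMul R I (D i : Set B) :=
    fun i j ↦ (hD i j).imp fun _ h ↦
      ⟨rIdealSMul_mono I h.1, rIdealSMul_mono I h.2⟩
  rw [← AddSubgroup.mem_iSup_of_directed hdir]
  refine (AddSubgroup.closure_le _).2 ?_ hb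
  rintro _ ⟨r, hr, n, hn, rfl⟩
  obtain ⟨i, hi⟩ := (Submodule.mem_iSup_of_directed _ hD).1 hn
  exact (AddSubgroup.mem_iSup_of_directed hdir).2
    ⟨i, AddSubgroup.subset_closure ⟨r, hr, n, hi, rfl⟩⟩

end RIdealSMul

section Characters

variable {R : Type u} [Ring R]

theorem AddMonoidHom.exists_character_comp_eq {A B : Type*} [AddCommGroup A] [AddCommGroup B]
    (f : A →+ B) (c : A →+ AddCircle (1 : ℚ)) (h : f.ker ≤ c.ker) :
    ∃ c' : B →+ AddCircle (1 : ℚ), c'.comp f = c := by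
  obtain ⟨c', hc'⟩ := CharacterModule.dual_surjective_of_injective
    (QuotientAddGroup.kerLift f).toIntLinearMap (QuotientAddGroup.kerLift_injective f)
    (QuotientAddGroup.lift f.ker c h)
  refine ⟨c', AddMonoidHom.ext fun a ↦ ?_⟩
  exact DFunLike.congr_fun hc' (a : A ⧸ f.ker)

variable (R) in
/-- The character group of the right module `R ⧸ I`: the additive characters of `R` that vanish
on the right ideal `I`. -/
def quotientCharacters (I : Ideal Rᵐᵒᵖ) : AddSubgroup (R →+ AddCircle (1 : ℚ)) where
  carrier := {φ | ∀ i ∈ I, φ i.unop = 0}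
  zero_mem' _ _ := rfl
  add_mem' hφ hψ i hi := by simp [hφ i hi, hψ i hi]
  neg_mem' hφ i hi := by simp [hφ i hi]

instance (I : Ideal Rᵐᵒᵖ) : SMul R (quotientCharacters R I) where
  smul r φ := ⟨φ.1.comp (AddMonoidHom.mulRight r), fun i hi ↦
    φ.2 (MulOpposite.op r * i) (I.mul_mem_left _ hi)⟩

theorem quotientCharacters_smul_apply {I : Ideal Rᵐᵒᵖ} (r : R) (φ : quotientCharacters R I)
    (x : R) : (r • φ).1 x = φ.1 (x * r) := rfl

instance (I : Ideal Rᵐᵒᵖ) : Module R (quotientCharacters R I) where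
  one_smul φ := by ext x; simp [quotientCharacters_smul_apply]
  mul_smul r s φ := by ext x; simp [quotientCharacters_smul_apply, mul_assoc]
  smul_zero r := by ext x; rfl
  smul_add r φ ψ := by ext x; rfl
  add_smul r s φ := by ext x; simp [quotientCharacters_smul_apply, mul_add]
  zero_smul φ := by ext x; simp [quotientCharacters_smul_apply]

/-- The homomorphism to the character module of `R ⧸ I` induced by a character killing `I • B`. -/
def toQuotientCharacters {B : Type*} [AddCommGroup B] [Module R B] (I : Ideal Rᵐᵒᵖ)
    (c : B →+ AddCircle (1 : ℚ)) (hc : rIdealSMul R I (Set.univ : Set B) ≤ c.ker) :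
    B →ₗ[R] quotientCharacters R I where
  toFun b := ⟨c.comp (LinearMap.toSpanSingleton R B b).toAddMonoidHom, fun i hi ↦
    hc (AddSubgroup.subset_closure ⟨i, hi, b, trivial, rfl⟩)⟩
  map_add' a b := by ext x; simp
  map_smul' r b := by ext x; simp [quotientCharacters_smul_apply, mul_smul]

end Characters

section ConeatInjective

variable {R : Type u} [Ring R]

theorem IsConeatSubmodule.mem_rIdealSMul {B : Type*} [AddCommGroup B] [Module R B]
    {A : Submodule R B} (hA : IsConeatSubmodule R A) {I : Ideal Rᵐᵒᵖ} (hI : I = ⊥ ∨ I.IsMaximal)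
    {a : B} (ha : a ∈ A) (haI : a ∈ rIdealSMul R I (Set.univ : Set B)) :
    a ∈ rIdealSMul R I (A : Set B) := by
  obtain rfl | hI := hI
  · rw [eq_zero_of_mem_rIdealSMul_bot haI]
    exact zero_mem _
  · exact hA I hI a ha haI

theorem mem_rIdealSMul_subtype {B : Type*} [AddCommGroup B] [Module R B] {A : Submodule R B}
    {I : Ideal Rᵐᵒᵖ} {a : A} :
    (a : B) ∈ rIdealSMul R I (A : Set B) ↔ a ∈ rIdealSMul R I (Set.univ : Set A) := by
  have h := rIdealSMul_image I A.subtype Set.univ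
  rw [Set.image_univ, Submodule.coe_subtype, Subtype.range_coe] at h
  rw [show rIdealSMul R I (A : Set B) = _ from h]
  exact AddSubgroup.mem_map_iff_mem (f := A.subtype.toAddMonoidHom) A.subtype_injective

theorem isConeatInjective_quotientCharacters {I : Ideal Rᵐᵒᵖ} (hI : I = ⊥ ∨ I.IsMaximal) :
    IsConeatInjective R (quotientCharacters R I) := by
  intro B A hA f
  let ev : quotientCharacters R I →+ AddCircle (1 : ℚ) :=
    (AddMonoidHom.eval (1 : R)).comp (quotientCharacters R I).subtype
  let q := (QuotientAddGroup.mk' (rIdealSMul R I (Set.univ : Set B)))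
  obtain ⟨c, hc⟩ := (q.comp A.subtype.toAddMonoidHom).exists_character_comp_eq
    (ev.comp f.toAddMonoidHom) fun a ha ↦ by
      have haI : (a : B) ∈ rIdealSMul R I (Set.univ : Set B) :=
        (QuotientAddGroup.eq_zero_iff _).1 ha
      refine (AddSubgroup.closure_le _).2 ?_
        (mem_rIdealSMul_subtype.1 (hA.mem_rIdealSMul hI a.2 haI))
      rintro _ ⟨i, hi, b, -, rfl⟩
      have := (f b).2 i hi
      simpa [ev, quotientCharacters_smul_apply] using this
  refine ⟨toQuotientCharacters I (c.comp q) fun b hb ↦ ?_, ?_⟩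
  · have : q b = 0 := (QuotientAddGroup.eq_zero_iff _).2 hb
    simp [this]
  · ext a r
    have := DFunLike.congr_fun hc (r • a)
    simpa [ev, quotientCharacters_smul_apply, toQuotientCharacters] using this

theorem isConeatInjective_pi {ι : Type u} (E : ι → Type u) [∀ i, AddCommGroup (E i)]
    [∀ i, Module R (E i)] (hE : ∀ i, IsConeatInjective R (E i)) :
    IsConeatInjective R (∀ i, E i) := by
  intro B A hA f
  choose g hg using fun i ↦ hE i B A hA (LinearMap.proj i ∘ₗ f)
  refine ⟨LinearMap.pi g, ?_⟩
  ext a i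
  exact DFunLike.congr_fun (hg i) a

theorem IsConeatInjective.of_retract {E X : Type v} [AddCommGroup E] [Module R E]
    [AddCommGroup X] [Module R X] (hE : IsConeatInjective R E) (h : X →ₗ[R] E) (s : E →ₗ[R] X)
    (hsh : s ∘ₗ h = LinearMap.id) : IsConeatInjective R X := by
  intro B A hA f
  obtain ⟨g, hg⟩ := hE B A hA (h ∘ₗ f)
  exact ⟨s ∘ₗ g, by rw [LinearMap.comp_assoc, hg, ← LinearMap.comp_assoc, hsh, LinearMap.id_comp]⟩

end ConeatInjective

section ConeatKernel

variable {R : Type u} [Ring R] {M P X Y : Type v} [AddCommGroup M] [Module R M] [AddCommGroup P]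
  [Module R P] [AddCommGroup X] [Module R X] [AddCommGroup Y] [Module R Y]

/-- For `ι : M → P` with image in `D`, the induced map `M → D ⧸ (N ⊓ D)` is injective with
coneat image. The ideal `⊥` accounts for injectivity. -/
def IsConeatKernel (ι : M →ₗ[R] P) (D N : Submodule R P) : Prop :=
  ∀ I : Ideal Rᵐᵒᵖ, I = ⊥ ∨ I.IsMaximal → ∀ (m : M), ∀ d ∈ rIdealSMul R I (D : Set P),
    ι m - d ∈ N → m ∈ rIdealSMul R I (Set.univ : Set M)

/-- `e` is injective with coneat image. -/
def IsConeatMono (e : M →ₗ[R] X) : Prop := IsConeatKernel e ⊤ ⊥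

/-- `e` is injective with coneat image, and this fails for the induced map into any proper
quotient. -/
def IsConeatEssential (e : M →ₗ[R] X) : Prop :=
  IsConeatMono e ∧ ∀ K : Submodule R X, IsConeatKernel e ⊤ K → K = ⊥

theorem isConeatMono_iff {e : M →ₗ[R] X} :
    IsConeatMono e ↔ ∀ I : Ideal Rᵐᵒᵖ, I = ⊥ ∨ I.IsMaximal → ∀ m : M,
      e m ∈ rIdealSMul R I (Set.univ : Set X) → m ∈ rIdealSMul R I (Set.univ : Set M) := by
  simp only [IsConeatMono, IsConeatKernel, Submodule.mem_bot, sub_eq_zero, Submodule.top_coe]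
  exact ⟨fun h I hI m hm ↦ h I hI m _ hm rfl, fun h I hI m d hd hmd ↦ h I hI m (hmd ▸ hd)⟩

theorem IsConeatMono.injective {e : M →ₗ[R] X} (he : IsConeatMono e) : Function.Injective e :=
  (injective_iff_map_eq_zero e).2 fun m hm ↦ eq_zero_of_mem_rIdealSMul_bot
    (isConeatMono_iff.1 he ⊥ (.inl rfl) m (hm ▸ zero_mem _))

theorem IsConeatMono.isConeatSubmodule_range {e : M →ₗ[R] X} (he : IsConeatMono e) :
    IsConeatSubmodule R (LinearMap.range e) := by
  rintro I hI _ ⟨m, rfl⟩ hm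
  refine map_mem_rIdealSMul e ?_ (isConeatMono_iff.1 he I (.inr hI) m hm)
  exact fun m _ ↦ ⟨m, rfl⟩

theorem IsConeatInjective.exists_comp_eq {e : M →ₗ[R] X} (hY : IsConeatInjective R Y)
    (he : IsConeatMono e) (g : M →ₗ[R] Y) : ∃ h : X →ₗ[R] Y, h ∘ₗ e = g := by
  obtain ⟨h, hh⟩ := hY (ModuleCat.of R X) _ he.isConeatSubmodule_range
    (g ∘ₗ (LinearEquiv.ofInjective e he.injective).symm.toLinearMap)
  refine ⟨h, LinearMap.ext fun m ↦ ?_⟩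
  have := DFunLike.congr_fun hh (LinearEquiv.ofInjective e he.injective m)
  simpa using this

theorem IsConeatEssential.injective_of_comp {e : M →ₗ[R] X} (he : IsConeatEssential e)
    {g : X →ₗ[R] Y} (h : IsConeatMono (g ∘ₗ e)) : Function.Injective g := by
  refine LinearMap.ker_eq_bot.1 (he.2 _ fun I hI m d hd hmd ↦ isConeatMono_iff.1 h I hI m ?_)
  rw [LinearMap.mem_ker, map_sub, sub_eq_zero] at hmd
  rw [LinearMap.comp_apply, hmd]
  exact map_mem_rIdealSMul g (Set.mapsTo_univ _ _) hd

theorem isConeatKernel_iff_of_surjective {ι : M →ₗ[R] P} {D N : Submodule R P}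
    (hι : ∀ m, ι m ∈ D) {π : D →ₗ[R] X} (hπ : Function.Surjective π) {K : Submodule R X}
    (hN : ∀ d : D, (d : P) ∈ N ↔ π d ∈ K) :
    IsConeatKernel ι D N ↔ IsConeatKernel (π ∘ₗ ι.codRestrict D hι) ⊤ K := by
  constructor
  · intro h I hI m x hx hmx
    have hx' := rIdealSMul_image I π Set.univ
    rw [Set.image_univ, hπ.range_eq] at hx'
    rw [Submodule.top_coe, hx'] at hx
    obtain ⟨d, hd, rfl⟩ := hx
    refine h I hI m d (mem_rIdealSMul_subtype.2 hd) ?_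
    exact (hN (ι.codRestrict D hι m - d)).2 (by rw [map_sub]; exact hmx)
  · intro h I hI m d hd hmd
    have hdD : d ∈ D := rIdealSMul_le I D hd
    refine h I hI m (π ⟨d, hdD⟩) (map_mem_rIdealSMul π (Set.mapsTo_univ _ _)
      (mem_rIdealSMul_subtype.1 hd)) ?_
    rw [LinearMap.comp_apply, ← map_sub]
    have hmdN : ((ι.codRestrict D hι m - ⟨d, hdD⟩ : D) : P) ∈ N := hmd
    exact (hN _).1 hmdN

/-- `N` is maximal among the kernels in `D` for which `M → D ⧸ N` is injective with coneat
image. -/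
structure IsMaximalConeatKernel (ι : M →ₗ[R] P) (D N : Submodule R P) : Prop where
  le : N ≤ D
  isConeatKernel : IsConeatKernel ι D N
  inf_le : ∀ N', N ≤ N' → IsConeatKernel ι D N' → N' ⊓ D ≤ N

theorem isMaximalConeatKernel_iff_of_surjective {ι : M →ₗ[R] P} {D N : Submodule R P}
    (hι : ∀ m, ι m ∈ D) {π : D →ₗ[R] X} (hπ : Function.Surjective π) (hND : N ≤ D)
    (hN : ∀ d : D, (d : P) ∈ N ↔ π d = 0) :
    IsMaximalConeatKernel ι D N ↔ IsConeatEssential (π ∘ₗ ι.codRestrict D hι) := by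
  have hgood : IsConeatKernel ι D N ↔ IsConeatMono (π ∘ₗ ι.codRestrict D hι) :=
    isConeatKernel_iff_of_surjective hι hπ hN
  constructor
  · refine fun h ↦ ⟨hgood.1 h.isConeatKernel, fun K hK ↦ (Submodule.eq_bot_iff _).2 ?_⟩
    have hpull : ∀ d : D, (d : P) ∈ (K.comap π).map D.subtype ↔ π d ∈ K := by simp
    have hle := h.inf_le ((K.comap π).map D.subtype)
      (fun n hn ↦ (hpull ⟨n, hND hn⟩).2 ((hN ⟨n, hND hn⟩).1 hn ▸ K.zero_mem))
      ((isConeatKernel_iff_of_surjective hι hπ hpull).2 hK)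
    intro x hx
    obtain ⟨d, rfl⟩ := hπ x
    exact (hN d).1 (hle ⟨(hpull d).2 hx, d.2⟩)
  · refine fun h ↦ ⟨hND, hgood.2 h.1, fun N' hNN' hN' d ⟨hdN', hdD⟩ ↦ (hN ⟨d, hdD⟩).2 ?_⟩
    have hpush : ∀ d : D, (d : P) ∈ N' ↔ π d ∈ (N'.comap D.subtype).map π := by
      refine fun d ↦ ⟨fun hd ↦ ⟨d, hd, rfl⟩, fun ⟨d', hd', hdd'⟩ ↦ ?_⟩
      have : ((d - d' : D) : P) ∈ N' := hNN' ((hN _).2 (by rw [map_sub, hdd', sub_self]))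
      simpa using add_mem this hd'
    have := h.2 _ ((isConeatKernel_iff_of_surjective hι hπ hpush).1 hN')
    simpa [this] using (hpush ⟨d, hdD⟩).1 hdN'

theorem IsConeatKernel.iSup {κ : Type*} [Nonempty κ] {ι : M →ₗ[R] P} {D N : κ → Submodule R P}
    (hDN : Directed (· ≤ ·) fun i ↦ (D i, N i)) (h : ∀ i, IsConeatKernel ι (D i) (N i)) :
    IsConeatKernel ι (⨆ i, D i) (⨆ i, N i) := by
  intro I hI m d hd hmd
  obtain ⟨i, hi⟩ := exists_mem_rIdealSMul_of_directed
    (fun i j ↦ (hDN i j).imp fun _ h ↦ ⟨h.1.1, h.2.1⟩) hd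
  obtain ⟨j, hj⟩ := (Submodule.mem_iSup_of_directed _
    fun i j ↦ (hDN i j).imp fun _ h ↦ ⟨h.1.2, h.2.2⟩).1 hmd
  obtain ⟨k, hik, hjk⟩ := hDN i j
  exact h k I hI m d (rIdealSMul_mono I hik.1 hi) (hjk.2 hj)

theorem IsConeatKernel.of_le {ι : M →ₗ[R] P} {D D' N : Submodule R P} (h : IsConeatKernel ι D N)
    (hD : D' ≤ D) : IsConeatKernel ι D' N :=
  fun I hI m d hd hmd ↦ h I hI m d (rIdealSMul_mono I hD hd) hmd

theorem IsConeatMono.exists_isConeatEssential_mkQ {ι : M →ₗ[R] P} (hι : IsConeatMono ι) :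
    ∃ K : Submodule R P, IsConeatEssential (K.mkQ ∘ₗ ι) := by
  obtain ⟨K, -, hK⟩ := zorn_le_nonempty₀ {K : Submodule R P | IsConeatKernel ι ⊤ K}
    (fun c hc hchain K hK ↦ by
      have : Nonempty c := ⟨⟨K, hK⟩⟩
      refine ⟨⨆ i : c, i.1, ?_, fun z hz ↦ le_iSup (fun i : c ↦ i.1) ⟨z, hz⟩⟩
      have := IsConeatKernel.iSup (ι := ι) (D := fun _ : c ↦ ⊤) (N := fun i : c ↦ i.1)
        (fun i j ↦ (hchain.directedOn.directed_val i j).imp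
          fun k h ↦ ⟨⟨le_rfl, h.1⟩, ⟨le_rfl, h.2⟩⟩) fun i ↦ hc i.2
      simpa using this) ⊥ hι
  refine ⟨K, (isMaximalConeatKernel_iff_of_surjective (D := ⊤) (N := K) (fun _ ↦ trivial)
    (π := K.mkQ ∘ₗ Submodule.subtype ⊤) ?_ le_top (by simp)).1
    ⟨le_top, hK.prop, fun N' h hN' ↦ inf_le_left.trans (hK.le_of_ge hN' h)⟩⟩
  exact K.mkQ_surjective.comp fun x ↦ ⟨⟨x, trivial⟩, rfl⟩

end ConeatKernel

section Subquotient

variable {R P : Type*} [Ring R] [AddCommGroup P] [Module R P]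

/-- The quotient of `D` by `N ⊓ D`. -/
abbrev Subquotient (D N : Submodule R P) : Type _ := D ⧸ N.submoduleOf D

/-- The projection of `D` onto its quotient by `N ⊓ D`. -/
def Subquotient.proj (D N : Submodule R P) : D →ₗ[R] Subquotient D N := (N.submoduleOf D).mkQ

theorem Subquotient.proj_surjective (D N : Submodule R P) :
    Function.Surjective (Subquotient.proj D N) :=
  Submodule.mkQ_surjective _

theorem Subquotient.proj_eq_zero {D N : Submodule R P} {d : D} :
    Subquotient.proj D N d = 0 ↔ (d : P) ∈ N :=
  Submodule.Quotient.mk_eq_zero _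

end Subquotient

section Envelope

variable (R : Type u) [Ring R] (M : Type u) [AddCommGroup M] [Module R M]

theorem exists_isConeatMono_isConeatInjective :
    ∃ (E : ModuleCat.{u} R) (ι : M →ₗ[R] E), IsConeatInjective R E ∧ IsConeatMono ι := by
  let T := Σ I : {I : Ideal Rᵐᵒᵖ // I = ⊥ ∨ I.IsMaximal},
    {c : M →+ AddCircle (1 : ℚ) // rIdealSMul R I.1 (Set.univ : Set M) ≤ c.ker}
  let ι : M →ₗ[R] ∀ t : T, quotientCharacters R t.1.1 :=
    LinearMap.pi fun t ↦ toQuotientCharacters t.1.1 t.2.1 t.2.2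
  refine ⟨ModuleCat.of R (∀ t : T, quotientCharacters R t.1.1), ι,
    isConeatInjective_pi _ fun t ↦ isConeatInjective_quotientCharacters t.1.2,
    isConeatMono_iff.2 fun I hI m hm ↦ ?_⟩
  by_contra hmI
  let q := QuotientAddGroup.mk' (rIdealSMul R I (Set.univ : Set M))
  obtain ⟨c, hc⟩ := CharacterModule.exists_character_apply_ne_zero_of_ne_zero (a := q m)
    fun h ↦ hmI ((QuotientAddGroup.eq_zero_iff m).1 h)
  let c' : M →+ AddCircle (1 : ℚ) := AddMonoidHom.comp c q
  have hc' : rIdealSMul R I (Set.univ : Set M) ≤ c'.ker := fun b hb ↦ by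
    have : q b = 0 := (QuotientAddGroup.eq_zero_iff _).2 hb
    change c (q b) = 0
    rw [this, map_zero]
  have hev : rIdealSMul R I (Set.univ : Set (quotientCharacters R I)) ≤
      ((AddMonoidHom.eval (1 : R)).comp (quotientCharacters R I).subtype).ker := by
    refine (AddSubgroup.closure_le _).2 ?_
    rintro _ ⟨i, hi, φ, -, rfl⟩
    have := φ.2 i hi
    simpa [quotientCharacters_smul_apply] using this
  have h := hev (map_mem_rIdealSMul
    (LinearMap.proj (⟨⟨I, hI⟩, ⟨c', hc'⟩⟩ : T)) (Set.mapsTo_univ _ _) hm)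
  refine hc ?_
  have h1 : c' ((1 : R) • m) = 0 := h
  rwa [one_smul] at h1

variable {R M} {Λ : Type u}

variable (R M) in
/-- The elements of `M × R^(Λ)` whose second component is supported in `S`. -/
noncomputable def prodSupported (S : Set Λ) : Submodule R (M × (Λ →₀ R)) :=
  (Finsupp.supported R R S).comap (LinearMap.snd R M (Λ →₀ R))

theorem mem_prodSupported {S : Set Λ} {p : M × (Λ →₀ R)} :
    p ∈ prodSupported R M S ↔ p.2 ∈ Finsupp.supported R R S := Iff.rfl

theorem prodSupported_mono {S T : Set Λ} (h : S ⊆ T) : prodSupported R M S ≤ prodSupported R M T :=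
  Submodule.comap_mono (Finsupp.supported_mono h)

theorem inl_mem_prodSupported (S : Set Λ) (m : M) :
    LinearMap.inl R M (Λ →₀ R) m ∈ prodSupported R M S :=
  mem_prodSupported.2 (Submodule.zero_mem _)

theorem inr_single_mem_prodSupported {S : Set Λ} {l : Λ} (hl : l ∈ S) :
    LinearMap.inr R M (Λ →₀ R) (Finsupp.single l 1) ∈ prodSupported R M S :=
  mem_prodSupported.2 (Finsupp.single_mem_supported R 1 hl)

theorem prodSupported_le {S : Set Λ} {Q : Submodule R (M × (Λ →₀ R))}
    (hM : ∀ m, LinearMap.inl R M (Λ →₀ R) m ∈ Q)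
    (hS : ∀ l ∈ S, LinearMap.inr R M (Λ →₀ R) (Finsupp.single l 1) ∈ Q) :
    prodSupported R M S ≤ Q := by
  have h : Finsupp.supported R R S ≤ Q.comap (LinearMap.inr R M (Λ →₀ R)) := by
    rw [Finsupp.supported_eq_span_single, Submodule.span_le]
    rintro _ ⟨l, hl, rfl⟩
    exact hS l hl
  rintro ⟨m, x⟩ hx
  simpa using add_mem (hM m) (h hx)

theorem prodSupported_iUnion {κ : Type*} [Nonempty κ] (S : κ → Set Λ) :
    prodSupported R M (⋃ i, S i) = ⨆ i, prodSupported R M (S i) := by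
  refine le_antisymm (prodSupported_le (fun m ↦ ?_) fun l hl ↦ ?_)
    (iSup_le fun i ↦ prodSupported_mono (Set.subset_iUnion S i))
  · exact le_iSup (fun i ↦ prodSupported R M (S i)) (Classical.arbitrary κ)
      (inl_mem_prodSupported _ m)
  · obtain ⟨i, hi⟩ := Set.mem_iUnion.1 hl
    exact le_iSup (fun i ↦ prodSupported R M (S i)) i (inr_single_mem_prodSupported hi)

variable (R M Λ) in
/-- A presentation of an essential extension of `M` by pairwise distinct generators labelled by
a subset of `Λ`. -/
structure ConeatPresentation where
  support : Set Λ
  ker : Submodule R (M × (Λ →₀ R))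
  isMaximal : IsMaximalConeatKernel (LinearMap.inl R M (Λ →₀ R)) (prodSupported R M support) ker
  injOn : ∀ l ∈ support, ∀ l' ∈ support, LinearMap.inr R M (Λ →₀ R)
    (Finsupp.single l 1 - Finsupp.single l' 1) ∈ ker → l = l'

namespace ConeatPresentation

/-- `p.Extends q` if the extension presented by `q` contains the one presented by `p`. -/
def Extends (p q : ConeatPresentation R M Λ) : Prop :=
  p.support ⊆ q.support ∧ p.ker ≤ q.ker ∧ q.ker ⊓ prodSupported R M p.support ≤ p.ker

theorem Extends.trans {p q r : ConeatPresentation R M Λ} (h : p.Extends q) (h' : q.Extends r) :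
    p.Extends r :=
  ⟨h.1.trans h'.1, h.2.1.trans h'.2.1, fun _ hx ↦
    h.2.2 ⟨h'.2.2 ⟨hx.1, prodSupported_mono h.1 hx.2⟩, hx.2⟩⟩

theorem Extends.refl (p : ConeatPresentation R M Λ) : p.Extends p :=
  ⟨subset_rfl, le_rfl, inf_le_left⟩

instance : Nonempty (ConeatPresentation R M Λ) := by
  have h (d : prodSupported R M (∅ : Set Λ)) : (d : M × (Λ →₀ R)).2 = 0 := by
    have := mem_prodSupported.1 d.2
    rwa [Finsupp.supported_empty, Submodule.mem_bot] at this
  refine ⟨⟨∅, ⊥, (isMaximalConeatKernel_iff_of_surjective (inl_mem_prodSupported ∅)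
    (π := LinearMap.fst R M (Λ →₀ R) ∘ₗ Submodule.subtype _) ?_ bot_le fun d ↦ ?_).2
    ⟨isConeatMono_iff.2 fun I hI m hm ↦ hm, fun K hK ↦ (Submodule.eq_bot_iff _).2 fun m hm ↦
      eq_zero_of_mem_rIdealSMul_bot
        (hK ⊥ (.inl rfl) m 0 (zero_mem _) (by simpa using hm))⟩, by simp⟩⟩
  · exact fun m ↦ ⟨⟨_, inl_mem_prodSupported ∅ m⟩, rfl⟩
  · rw [Submodule.mem_bot, Prod.ext_iff]
    simp [h d]

theorem exists_extends_maximal :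
    ∃ p : ConeatPresentation R M Λ, ∀ q, p.Extends q → q.Extends p := by
  refine exists_maximal_of_nonempty_chains_bounded (fun c hc hne ↦ ?_) Extends.trans
  have : Nonempty c := hne.to_subtype
  have htot (p q : c) : ∃ r : c, p.1.Extends r ∧ q.1.Extends r := by
    by_cases hpq : p = q
    · exact ⟨p, .refl _, hpq ▸ .refl _⟩
    · rcases hc p.2 q.2 (Subtype.coe_ne_coe.2 hpq) with h | h
      · exact ⟨q, h, .refl _⟩
      · exact ⟨p, .refl _, h⟩
  have hD : Directed (· ≤ ·) fun p : c ↦ prodSupported R M p.1.support := fun p q ↦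
    (htot p q).imp fun _ h ↦ ⟨prodSupported_mono h.1.1, prodSupported_mono h.2.1⟩
  have hN : Directed (· ≤ ·) fun p : c ↦ p.1.ker := fun p q ↦
    (htot p q).imp fun _ h ↦ ⟨h.1.2.1, h.2.2.1⟩
  have hinf (p : c) : (⨆ q : c, q.1.ker) ⊓ prodSupported R M p.1.support ≤ p.1.ker := by
    rintro x ⟨hx, hxp⟩
    obtain ⟨q, hq⟩ := (Submodule.mem_iSup_of_directed _ hN).1 hx
    obtain ⟨r, hpr, hqr⟩ := htot p q
    exact hpr.2.2 ⟨hqr.2.1 hq, hxp⟩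
  refine ⟨⟨⋃ p : c, p.1.support, ⨆ p : c, p.1.ker, ?_, ?_⟩, fun p hp ↦ ⟨?_, ?_, hinf ⟨p, hp⟩⟩⟩
  · rw [prodSupported_iUnion]
    refine ⟨iSup_mono fun p ↦ p.1.isMaximal.le, IsConeatKernel.iSup (fun p q ↦ ?_)
      fun p ↦ p.1.isMaximal.isConeatKernel, fun N' hN' h x hx ↦ ?_⟩
    · exact (htot p q).imp fun _ h ↦
        ⟨⟨prodSupported_mono h.1.1, h.1.2.1⟩, ⟨prodSupported_mono h.2.1, h.2.2.1⟩⟩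
    · obtain ⟨p, hp⟩ := (Submodule.mem_iSup_of_directed _ hD).1 hx.2
      exact le_iSup (fun p : c ↦ p.1.ker) p (p.1.isMaximal.inf_le N'
        ((le_iSup (fun p : c ↦ p.1.ker) p).trans hN')
        (h.of_le (le_iSup (fun p : c ↦ prodSupported R M p.1.support) p)) ⟨hx.1, hp⟩)
  · intro l hl l' hl' h
    obtain ⟨p, hp⟩ := Set.mem_iUnion.1 hl
    obtain ⟨q, hq⟩ := Set.mem_iUnion.1 hl'
    obtain ⟨r, hpr, hqr⟩ := htot p q
    refine r.1.injOn l (hpr.1 hp) l' (hqr.1 hq) (hinf r ⟨h, ?_⟩)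
    rw [map_sub]
    exact sub_mem (inr_single_mem_prodSupported (hpr.1 hp))
      (inr_single_mem_prodSupported (hqr.1 hq))
  · exact Set.subset_iUnion (fun p : c ↦ p.1.support) ⟨p, hp⟩
  · exact le_iSup (fun p : c ↦ p.1.ker) ⟨p, hp⟩

/-- The extension of `M` presented by `p`. -/
abbrev Extension (p : ConeatPresentation R M Λ) : Type u :=
  Subquotient (prodSupported R M p.support) p.ker

/-- The embedding of `M` into the extension presented by `p`. -/
noncomputable def embedding (p : ConeatPresentation R M Λ) : M →ₗ[R] p.Extension :=
  Subquotient.proj _ _ ∘ₗ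
    (LinearMap.inl R M (Λ →₀ R)).codRestrict _ (inl_mem_prodSupported p.support)

theorem isConeatEssential_embedding (p : ConeatPresentation R M Λ) :
    IsConeatEssential p.embedding :=
  (isMaximalConeatKernel_iff_of_surjective (inl_mem_prodSupported p.support)
    (Subquotient.proj_surjective _ _) p.isMaximal.le
    fun _ ↦ Subquotient.proj_eq_zero.symm).1 p.isMaximal

/-- The generator with label `l` of the extension presented by `p`. -/
noncomputable def generator (p : ConeatPresentation R M Λ) (l : p.support) : p.Extension :=
  Subquotient.proj _ _ ⟨_, inr_single_mem_prodSupported l.2⟩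

theorem generator_injective (p : ConeatPresentation R M Λ) : Function.Injective p.generator := by
  intro l l' h
  rw [generator, generator, ← sub_eq_zero, ← map_sub, Subquotient.proj_eq_zero] at h
  exact Subtype.ext (p.injOn l l.2 l' l'.2 (by rw [map_sub]; exact h))

theorem surjective_of_extends_maximal {p : ConeatPresentation R M Λ}
    (hp : ∀ q, p.Extends q → q.Extends p) {F : Type u} [AddCommGroup F] [Module R F]
    {e : M →ₗ[R] F} (he : IsConeatEssential e) (k : p.Extension →ₗ[R] F)
    (hk : k ∘ₗ p.embedding = e) (hinj : Function.Injective k)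
    (j : F ↪ (p.supportᶜ : Set Λ)) : Function.Surjective k := by
  classical
  let T : Set Λ := p.support ∪ (fun y ↦ (j y : Λ)) '' (Set.range k)ᶜ
  let ψ : Λ → F := fun l ↦ if h : l ∈ p.support then k (p.generator ⟨l, h⟩) else
    Function.extend (fun y ↦ (j y : Λ)) id 0 l
  have hψj (y : F) : ψ (j y) = y := by
    simp only [ψ, dif_neg (j y).2]
    exact (Subtype.val_injective.comp j.injective).extend_apply id 0 y
  have hψp (l : p.support) : ψ l = k (p.generator l) := by simp [ψ]
  let Φ : M × (Λ →₀ R) →ₗ[R] F := e.coprod (Finsupp.linearCombination R ψ)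
  have hΦl (l : Λ) : Φ (LinearMap.inr R M (Λ →₀ R) (Finsupp.single l 1)) = ψ l := by simp [Φ]
  have hΦ (d : prodSupported R M p.support) : Φ d = k (Subquotient.proj _ _ d) := by
    have : prodSupported R M p.support ≤ (LinearMap.eqLocus (Φ ∘ₗ Submodule.subtype _)
        (k ∘ₗ Subquotient.proj _ _)).map (Submodule.subtype _) := by
      refine prodSupported_le (fun m ↦ ⟨⟨_, inl_mem_prodSupported p.support m⟩, ?_, rfl⟩)
        fun l hl ↦ ⟨⟨_, inr_single_mem_prodSupported hl⟩, ?_, rfl⟩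
      · refine Eq.trans ?_ (DFunLike.congr_fun hk m).symm
        simp [Φ]
      · exact (hΦl l).trans (hψp ⟨l, hl⟩)
    obtain ⟨d', hd', hdd'⟩ := this d.2
    rwa [Subtype.ext hdd'] at hd'
  have hsurj : Function.Surjective (Φ ∘ₗ (prodSupported R M T).subtype) := by
    intro y
    by_cases hy : y ∈ Set.range k
    · obtain ⟨x, rfl⟩ := hy
      obtain ⟨d, rfl⟩ := Subquotient.proj_surjective _ _ x
      exact ⟨⟨d, prodSupported_mono Set.subset_union_left d.2⟩, hΦ d⟩
    · exact ⟨⟨_, inr_single_mem_prodSupported (.inr ⟨y, hy, rfl⟩)⟩, (hΦl _).trans (hψj y)⟩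
  have hψT : Set.InjOn ψ T := by
    rintro l (hl | ⟨y, hy, rfl⟩) l' (hl' | ⟨y', hy', rfl⟩) h
    · rw [hψp ⟨l, hl⟩, hψp ⟨l', hl'⟩] at h
      exact congrArg Subtype.val (p.generator_injective (hinj h))
    · rw [hψp ⟨l, hl⟩, hψj] at h
      exact absurd ⟨_, h⟩ hy'
    · rw [hψp ⟨l', hl'⟩, hψj] at h
      exact absurd ⟨_, h.symm⟩ hy
    · rw [hψj, hψj] at h
      exact h ▸ rfl
  have heΦ : (Φ ∘ₗ (prodSupported R M T).subtype) ∘ₗ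
      (LinearMap.inl R M (Λ →₀ R)).codRestrict _ (inl_mem_prodSupported T) = e := by
    ext m
    simp [Φ]
  let q : ConeatPresentation R M Λ :=
    { support := T
      ker := LinearMap.ker Φ ⊓ prodSupported R M T
      isMaximal := (isMaximalConeatKernel_iff_of_surjective (inl_mem_prodSupported T) hsurj
        inf_le_right fun d ↦ by simp).2 (by rwa [heΦ])
      injOn := fun l hl l' hl' h ↦ hψT hl hl' (by
        have := LinearMap.mem_ker.1 h.1
        rwa [map_sub, map_sub, hΦl, hΦl, sub_eq_zero] at this) }
  have hq : p.Extends q := by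
    refine ⟨Set.subset_union_left, fun n hn ↦ ⟨?_, ?_⟩, fun n hn ↦ ?_⟩
    · rw [SetLike.mem_coe, LinearMap.mem_ker, hΦ ⟨n, p.isMaximal.le hn⟩,
        Subquotient.proj_eq_zero.2 hn, map_zero]
    · exact prodSupported_mono Set.subset_union_left (p.isMaximal.le hn)
    · have h0 := LinearMap.mem_ker.1 hn.1.1
      rw [hΦ ⟨n, hn.2⟩, ← map_zero k] at h0
      exact Subquotient.proj_eq_zero.1 (hinj h0)
  intro y
  by_contra hy
  exact (j y).2 ((hp q hq).1 (.inr ⟨y, hy, rfl⟩))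

end ConeatPresentation

end Envelope

/-- Every left `R`-module `M` admits a coneat injective envelope `e : M → E`,
and the image `e(M)` is a coneat submodule of `E`; in particular every module embeds as a
coneat submodule of a coneat injective module. -/
theorem exists_coneatInjectiveEnvelope (R : Type u) [Ring R]
    (M : Type u) [AddCommGroup M] [Module R M] :
    ∃ (E : ModuleCat.{u} R) (e : M →ₗ[R] E),
      IsConeatInjectiveEnvelope R e ∧ IsConeatSubmodule R (LinearMap.range e) := by
  obtain ⟨E, ι, hE, hι⟩ := exists_isConeatMono_isConeatInjective R M
  obtain ⟨p, hp⟩ := ConeatPresentation.exists_extends_maximal (R := R) (M := M) (Λ := Set (E ⊕ ℕ))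
  have he := p.isConeatEssential_embedding
  have hsurj {F : Type u} [AddCommGroup F] [Module R F] {f : M →ₗ[R] F} (hf : IsConeatEssential f)
      (k : p.Extension →ₗ[R] F) (hk : k ∘ₗ p.embedding = f) : Function.Bijective k := by
    have hinj : Function.Injective k := he.injective_of_comp (by rw [hk]; exact hf.1)
    refine ⟨hinj, ?_⟩
    obtain ⟨i, hi⟩ := hE.exists_comp_eq hf.1 ι
    have hi : Function.Injective i := hf.injective_of_comp (by rwa [hi])
    have hE' : Cardinal.mk E < Cardinal.mk (Set (E ⊕ ℕ)) :=
      (Cardinal.mk_le_of_injective (Sum.inl_injective (β := ℕ))).trans_lt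
        (Cardinal.mk_set (α := E ⊕ ℕ) ▸ Cardinal.cantor _)
    have hS : Cardinal.mk p.support < Cardinal.mk (Set (E ⊕ ℕ)) :=
      (Cardinal.mk_le_of_injective
        ((hi.comp hinj).comp p.generator_injective)).trans_lt hE'
    have hF : Cardinal.mk F ≤ Cardinal.mk (p.supportᶜ : Set (Set (E ⊕ ℕ))) := by
      rw [Cardinal.mk_compl_of_infinite _ hS]
      exact (Cardinal.mk_le_of_injective hi).trans hE'.le
    exact ConeatPresentation.surjective_of_extends_maximal hp hf k hk hinj hF.some
  obtain ⟨h, hh⟩ := hE.exists_comp_eq he.1 ι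
  obtain ⟨K, hK⟩ := hι.exists_isConeatEssential_mkQ
  let s := LinearEquiv.ofBijective (K.mkQ ∘ₗ h)
    (hsurj hK _ (by rw [LinearMap.comp_assoc, hh]))
  refine ⟨ModuleCat.of R p.Extension, p.embedding, ⟨he.1.injective, ?_, fun C hC g ↦
    hC.exists_comp_eq he.1 g, fun f hf ↦ hsurj he f hf⟩, he.1.isConeatSubmodule_range⟩
  exact hE.of_retract h (s.symm.toLinearMap ∘ₗ K.mkQ) (LinearMap.ext fun x ↦ s.symm_apply_apply x)
end

section
/- For every prime number p, the ℤ-module ℤ/pℤ is coneat injective but not injective. -/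
/-!
Basic notions from the theory of coneat exact sequences.

A short exact sequence `0 → A → B → C → 0` of left `R`-modules is *coneat exact* if for every
simple right `R`-module `S` the induced map `S ⊗[R] A → S ⊗[R] B` is injective.  Since every
simple right `R`-module is isomorphic to `R ⧸ I` for a maximal right ideal `I` (realized below
as a left ideal `I : Ideal Rᵐᵒᵖ`), and since `(R ⧸ I) ⊗[R] B ≅ B ⧸ I•B` (as abelian groups,
where `I•B` is the additive subgroup generated by the products `i • b`, `i ∈ I`, `b ∈ B`),
this is equivalent to the elementwise condition `A ∩ I•B ⊆ I•A` for every maximal right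
ideal `I`, which is the formulation used here (Mathlib has no tensor product of a right module
with a left module over a noncommutative ring).
-/

universe u v

/-- Over a commutative ring, a coneat submodule `A` of `B` satisfies `A ∩ I • B ⊆ ker f` for every
maximal ideal `I` and every homomorphism `f` from `A` to a module killed by `I`. -/
theorem IsConeatSubmodule.map_eq_zero_of_mem_smul_top {R : Type*} [CommRing R] {I : Ideal R}
    [hI : I.IsMaximal] {B M : Type*} [AddCommGroup B] [Module R B] [AddCommGroup M] [Module R M]
    (hM : Module.IsTorsionBySet R M I) {A : Submodule R B} (hA : IsConeatSubmodule R A)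
    (f : A →ₗ[R] M) (a : A) (ha : (a : B) ∈ I • (⊤ : Submodule R B)) : f a = 0 := by
  have hJ : (I.comap (RingEquiv.toOpposite R).symm).IsMaximal :=
    Ideal.comap_isMaximal_of_equiv (RingEquiv.toOpposite R).symm
  have hker : rIdealSMul R (I.comap (RingEquiv.toOpposite R).symm) (A : Set B) ≤
      (f.ker.map A.subtype).toAddSubgroup := by
    refine (AddSubgroup.closure_le _).2 ?_
    rintro _ ⟨i, hi, n, hn, rfl⟩
    refine ⟨i.unop • ⟨n, hn⟩, ?_, rfl⟩
    exact (f.map_smul _ _).trans (hM (a := ⟨i.unop, hi⟩))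
  have ha' : (a : B) ∈ rIdealSMul R (I.comap (RingEquiv.toOpposite R).symm) Set.univ :=
    Submodule.smul_induction_on ha
      (fun r hr b _ => AddSubgroup.subset_closure ⟨MulOpposite.op r, hr, b, Set.mem_univ b, rfl⟩)
      (fun _ _ => add_mem)
  obtain ⟨a', h0, h⟩ := hker (hA _ hJ a a.2 ha')
  rwa [← Subtype.ext h]

/-- Over a commutative ring, every module killed by a maximal ideal is coneat injective. -/
theorem isConeatInjective_of_isTorsionBySet {R : Type u} [CommRing R] {I : Ideal R}
    [I.IsMaximal] {M : Type v} [AddCommGroup M] [Module R M]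
    (hM : Module.IsTorsionBySet R M I) : IsConeatInjective R M := by
  intro B A hA f
  let _ : Field (R ⧸ I) := Ideal.Quotient.field I
  let P : Submodule R B := I • ⊤
  let j : A →ₗ[R] B ⧸ P := P.mkQ.comp A.subtype
  have hj : j.ker ≤ f.ker := fun a ha =>
    hA.map_eq_zero_of_mem_smul_top hM f a ((Submodule.Quotient.mk_eq_zero P).1 ha)
  let e : (A ⧸ j.ker) →ₗ[R] B ⧸ P := j.ker.liftQ j le_rfl
  have he : Function.Injective e := LinearMap.ker_eq_bot.1 (Submodule.ker_liftQ_eq_bot' _ _ rfl)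
  have hV : Module.IsTorsionBySet R (B ⧸ P) I := Module.isTorsionBySet_quotient_ideal_smul B I
  have hU : Module.IsTorsionBySet R (A ⧸ j.ker) I := fun x r =>
    he ((e.map_smul (r : R) x).trans (hV.trans e.map_zero.symm))
  let _ : Module (R ⧸ I) (B ⧸ P) := hV.module
  let _ : Module (R ⧸ I) (A ⧸ j.ker) := hU.module
  have : IsScalarTower R (R ⧸ I) (B ⧸ P) := hV.isScalarTower
  have : IsScalarTower R (R ⧸ I) (A ⧸ j.ker) := hU.isScalarTower
  obtain ⟨g, hg⟩ := (e.extendScalarsOfSurjective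
    (S := R ⧸ I) Ideal.Quotient.mk_surjective).exists_leftInverse_of_injective
    (LinearMap.ker_eq_bot.2 he)
  refine ⟨(j.ker.liftQ f hj).comp ((g.restrictScalars R).comp P.mkQ), ?_⟩
  ext a
  exact congrArg (j.ker.liftQ f hj) (LinearMap.congr_fun hg (j.ker.mkQ a))

/-- The module `ℤ/pℤ` is coneat injective for every prime `p`. -/
theorem isConeatInjective_zmod_of_prime {p : ℕ} (hp : p.Prime) :
    IsConeatInjective ℤ (ZMod p) := by
  have : (Ideal.span {(p : ℤ)}).IsMaximal :=
    PrincipalIdealRing.isMaximal_of_irreducible (Nat.prime_iff_prime_int.mp hp).irreducible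
  refine isConeatInjective_of_isTorsionBySet (I := Ideal.span {(p : ℤ)}) ?_
  rintro x ⟨r, hr⟩
  obtain ⟨k, rfl⟩ := Ideal.mem_span_singleton.1 hr
  simp

/-- The module `ℤ/nℤ` is not injective for `n ≠ 0, 1`. -/
theorem not_injective_zmod {n : ℕ} (h₀ : n ≠ 0) (h₁ : n ≠ 1) :
    ¬ Module.Injective ℤ (ZMod n) := by
  intro h
  obtain ⟨g, hg⟩ := h.out (LinearMap.lsmul ℤ ℤ (n : ℤ))
    (fun a b hab => by simpa [h₀] using hab) (Int.castAddHom (ZMod n)).toIntLinearMap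
  have h1 : g ((n : ℤ) • 1) = 1 := by simpa using hg 1
  rw [map_smul] at h1
  have : Fact (1 < n) := ⟨by omega⟩
  simp at h1

/-- For every prime `p`, the `ℤ`-module `ℤ/pℤ` is coneat injective but not
injective. -/
theorem zmod_prime_coneatInjective_not_injective (p : ℕ) (hp : p.Prime) :
    IsConeatInjective ℤ (ZMod p) ∧ ¬ Module.Injective ℤ (ZMod p) := by
  exact ⟨isConeatInjective_zmod_of_prime hp, not_injective_zmod hp.ne_zero hp.ne_one⟩
end

section
/- For every prime number p and every integer k ≥ 2, the ℤ-module ℤ/p^kℤ is pure injective but not coneat injective. -/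
/-!
Basic notions from the theory of coneat exact sequences.

A short exact sequence `0 → A → B → C → 0` of left `R`-modules is *coneat exact* if for every
simple right `R`-module `S` the induced map `S ⊗[R] A → S ⊗[R] B` is injective.  Since every
simple right `R`-module is isomorphic to `R ⧸ I` for a maximal right ideal `I` (realized below
as a left ideal `I : Ideal Rᵐᵒᵖ`), and since `(R ⧸ I) ⊗[R] B ≅ B ⧸ I•B` (as abelian groups,
where `I•B` is the additive subgroup generated by the products `i • b`, `i ∈ I`, `b ∈ B`),
this is equivalent to the elementwise condition `A ∩ I•B ⊆ I•A` for every maximal right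
ideal `I`, which is the formulation used here (Mathlib has no tensor product of a right module
with a left module over a noncommutative ring).
-/

universe u v

/-- The `n`-torsion of `ℝ / ℤ` is the image of `ℤ / n`. -/
lemma exists_toAddCircle_eq_of_smul_eq_zero {n : ℕ} [NeZero n] {x : UnitAddCircle}
    (hx : (n : ℤ) • x = 0) : ∃ j : ZMod n, ZMod.toAddCircle j = x := by
  induction x using QuotientAddGroup.induction_on with
  | H y =>
    have h : (((n : ℤ) • y : ℝ) : UnitAddCircle) = 0 := by
      rw [AddCircle.coe_zsmul]; exact hx
    obtain ⟨m, hm⟩ := (AddCircle.coe_eq_zero_iff (1 : ℝ)).1 h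
    refine ⟨(m : ZMod n), ?_⟩
    rw [ZMod.toAddCircle_intCast]
    have hn : (n : ℝ) ≠ 0 := Nat.cast_ne_zero.2 (NeZero.ne n)
    congr 1
    simp only [zsmul_eq_mul, mul_one, Int.cast_natCast] at hm
    rw [hm]
    field_simp

/-- An element of a pure submodule divisible by `r` in the big module is divisible by `r` in the
submodule. -/
lemma IsPureSubmodule.exists_smul_eq {R : Type*} [Ring R] {B : Type*} [AddCommGroup B]
    [Module R B] {A : Submodule R B} (hA : IsPureSubmodule R A) {r : R} {a : A} {b : B}
    (h : (a : B) = r • b) : ∃ a' : A, a = r • a' := by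
  obtain ⟨a', ha'⟩ := hA 1 1 (fun _ _ => r) (fun _ => a) ⟨fun _ => b, fun _ => by simpa using h⟩
  exact ⟨a' 0, Subtype.ext (by simpa using ha' 0)⟩

/-- The `r`-torsion submodule of an injective module over a commutative ring is pure injective. -/
theorem IsPureInjective.of_range_eq_torsionBy {R : Type u} {M : Type v} {Q : Type*}
    [CommRing R] [AddCommGroup M] [Module R M] [AddCommGroup Q] [Module R Q]
    (hQ : Module.Baer R Q) (r : R) (ι : M →ₗ[R] Q)
    (hι : Function.Injective ι) (hr : LinearMap.range ι = Submodule.torsionBy R Q r) :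
    IsPureInjective R M := by
  intro B A hA f
  let N : Submodule R B := LinearMap.range (LinearMap.lsmul R B r)
  let ψ : A →ₗ[R] B ⧸ N := N.mkQ ∘ₗ A.subtype
  have hker : LinearMap.ker ψ ≤ LinearMap.ker (ι ∘ₗ f) := by
    intro a ha
    obtain ⟨b, hb⟩ := (Submodule.Quotient.mk_eq_zero N).1 (LinearMap.mem_ker.1 ha)
    obtain ⟨a', rfl⟩ := hA.exists_smul_eq (r := r) (a := a) (b := b) hb.symm
    have : ι (f a') ∈ Submodule.torsionBy R Q r := hr ▸ LinearMap.mem_range_self ι _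
    simpa using this
  obtain ⟨h, hh⟩ := hQ.extension_property ((LinearMap.ker ψ).liftQ ψ le_rfl)
    (LinearMap.ker_eq_bot.1 (Submodule.ker_liftQ_eq_bot _ _ _ le_rfl))
    ((LinearMap.ker ψ).liftQ (ι ∘ₗ f) hker)
  have hext (a : A) : h (N.mkQ a) = ι (f a) :=
    LinearMap.congr_fun hh (Submodule.Quotient.mk a)
  have hrange (b : B) : (h ∘ₗ N.mkQ) b ∈ LinearMap.range ι := by
    have hb : N.mkQ (r • b) = 0 := (Submodule.Quotient.mk_eq_zero N).2 ⟨b, rfl⟩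
    rw [hr, Submodule.mem_torsionBy_iff, ← map_smul, LinearMap.comp_apply, hb, map_zero]
  let e := LinearEquiv.ofInjective ι hι
  refine ⟨e.symm ∘ₗ (h ∘ₗ N.mkQ).codRestrict _ hrange, LinearMap.ext fun a => ?_⟩
  exact e.symm_apply_eq.2 (Subtype.ext (hext a))

/-- Finite cyclic groups are pure injective. -/
theorem isPureInjective_zmod (n : ℕ) [NeZero n] : IsPureInjective ℤ (ZMod n) := by
  refine .of_range_eq_torsionBy (Module.Baer.of_divisible UnitAddCircle) (n : ℤ)
    (ZMod.toAddCircle (N := n)).toIntLinearMap (ZMod.toAddCircle_injective n) (le_antisymm ?_ ?_)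
  · rintro _ ⟨j, rfl⟩
    rw [Submodule.mem_torsionBy_iff, ← map_smul]
    simp
  · intro x hx
    exact exists_toAddCircle_eq_of_smul_eq_zero hx

/-- The cyclic subgroup of `ℤ / p ^ (k + 1) × ℤ / p` generated by `(p, 1)` is coneat. -/
lemma isConeatSubmodule_span_prime_one (p k : ℕ) (hp : p.Prime) (hk : 1 ≤ k) :
    IsConeatSubmodule ℤ
      (Submodule.span ℤ {((p, 1) : ZMod (p ^ (k + 1)) × ZMod p)}) := by
  intro I hI a ha haI
  obtain ⟨c, rfl⟩ := Submodule.mem_span_singleton.1 ha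
  by_cases hdvd : ∀ z ∈ I, (p : ℤ) ∣ MulOpposite.unop z
  · have hpI : MulOpposite.op (p : ℤ) ∈ I := by
      have hle : I ≤ Ideal.span {MulOpposite.op (p : ℤ)} := by
        intro z hz
        obtain ⟨w, hw⟩ := hdvd z hz
        exact Ideal.mem_span_singleton'.2 ⟨MulOpposite.op w, MulOpposite.unop_injective hw.symm⟩
      have hne : Ideal.span {MulOpposite.op (p : ℤ)} ≠ ⊤ := by
        rw [Ne, Ideal.eq_top_iff_one, Ideal.mem_span_singleton']
        rintro ⟨w, hw⟩
        have hw' : (p : ℤ) * MulOpposite.unop w = 1 := congrArg MulOpposite.unop hw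
        exact (Nat.prime_iff_prime_int.1 hp).not_dvd_one ⟨_, hw'.symm⟩
      rw [hI.eq_of_le hne hle]
      exact Ideal.subset_span rfl
    have hsnd : rIdealSMul ℤ I (Set.univ : Set (ZMod (p ^ (k + 1)) × ZMod p)) ≤
        (AddMonoidHom.snd _ _).ker := by
      refine (AddSubgroup.closure_le _).2 ?_
      rintro _ ⟨z, hz, n, -, rfl⟩
      obtain ⟨w, hw⟩ := hdvd z hz
      change (MulOpposite.unop z • n).2 = 0
      simp [hw]
    have hc : ((c : ℤ) : ZMod p) = 0 := by
      have h : (c • ((p, 1) : ZMod (p ^ (k + 1)) × ZMod p)).2 = 0 := hsnd haI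
      simpa using h
    obtain ⟨d, rfl⟩ := (ZMod.intCast_zmod_eq_zero_iff_dvd c p).1 hc
    exact AddSubgroup.subset_closure ⟨_, hpI, _,
      Submodule.smul_mem _ d (Submodule.mem_span_singleton_self _), mul_smul _ _ _⟩
  · push Not at hdvd
    obtain ⟨z, hz, hpz⟩ := hdvd
    have hcop : IsCoprime (MulOpposite.unop z) ((p : ℤ) ^ k) :=
      (((Nat.prime_iff_prime_int.1 hp).coprime_iff_not_dvd.2 hpz).symm).pow_right
    obtain ⟨u, v, huv⟩ := hcop
    have hzero : ((p : ℤ) ^ k) • ((p, 1) : ZMod (p ^ (k + 1)) × ZMod p) = 0 := by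
      refine Prod.ext ?_ ?_
      · have := ZMod.natCast_self (p ^ (k + 1))
        simpa [pow_succ] using this
      · simp [show k ≠ 0 by lia]
    refine AddSubgroup.subset_closure ⟨z, hz, _,
      Submodule.smul_mem _ (c * u) (Submodule.mem_span_singleton_self _), ?_⟩
    have hc : c = MulOpposite.unop z * (c * u) + c * v * (p : ℤ) ^ k := by
      linear_combination (-c) * huv
    conv_lhs => rw [hc, add_smul, mul_smul (c * v), hzero, smul_zero, add_zero, mul_smul]

/-- `ℤ / p ^ k` is not coneat injective for `k ≥ 2`. -/
theorem not_isConeatInjective_zmod_prime_pow (p k : ℕ) (hp : p.Prime) (hk : 2 ≤ k) :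
    ¬ IsConeatInjective ℤ (ZMod (p ^ k)) := by
  intro H
  have hann (c : ℤ) (hc : c • ((p, 1) : ZMod (p ^ (k + 1)) × ZMod p) = 0) :
      c • (1 : ZMod (p ^ k)) = 0 := by
    have h1 : ((c * p : ℤ) : ZMod (p ^ (k + 1))) = 0 := by
      simpa using congrArg Prod.fst hc
    rw [ZMod.intCast_zmod_eq_zero_iff_dvd, pow_succ, Nat.cast_mul] at h1
    have h2 := Int.dvd_of_mul_dvd_mul_right (Int.natCast_ne_zero.2 hp.ne_zero) h1
    simpa using (ZMod.intCast_zmod_eq_zero_iff_dvd c (p ^ k)).2 h2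
  obtain ⟨g, hg⟩ := H (ModuleCat.of ℤ (ZMod (p ^ (k + 1)) × ZMod p)) _
    (isConeatSubmodule_span_prime_one p k hp (by lia))
    (LinearPMap.mkSpanSingleton' _ (1 : ZMod (p ^ k)) hann).toFun
  change ZMod (p ^ (k + 1)) × ZMod p →ₗ[ℤ] ZMod (p ^ k) at g
  have hg1 : g (p, 1) = 1 :=
    (LinearMap.congr_fun hg ⟨_, Submodule.mem_span_singleton_self _⟩).trans
      (LinearPMap.mkSpanSingleton'_apply_self _ _ hann _)
  obtain ⟨j, rfl⟩ : ∃ j, k = j + 2 := ⟨k - 2, by lia⟩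
  have hmul : ((p : ℤ) ^ (j + 1)) • ((p, 1) : ZMod (p ^ (j + 2 + 1)) × ZMod p) =
      ((p : ℤ) ^ (j + 2)) • (1, 0) := by
    refine Prod.ext ?_ ?_ <;> simp [pow_succ]
  have hzero : ((p ^ (j + 1) : ℕ) : ZMod (p ^ (j + 2))) = 0 := by
    have h := congrArg g hmul
    rw [map_smul, map_smul, hg1] at h
    have hp0 : ((p : ZMod (p ^ (j + 2))) ^ (j + 2)) = 0 := by
      exact_mod_cast ZMod.natCast_self (p ^ (j + 2))
    simpa [hp0] using h
  rw [ZMod.natCast_eq_zero_iff, Nat.pow_dvd_pow_iff_le_right hp.one_lt] at hzero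
  lia

/-- For every prime `p` and every `k ≥ 2`, the `ℤ`-module `ℤ/pᵏℤ` is pure
injective but not coneat injective. -/
theorem zmod_prime_pow_pureInjective_not_coneatInjective (p k : ℕ) (hp : p.Prime)
    (hk : 2 ≤ k) :
    IsPureInjective ℤ (ZMod (p ^ k)) ∧ ¬ IsConeatInjective ℤ (ZMod (p ^ k)) := by
  have : NeZero (p ^ k) := ⟨pow_ne_zero k hp.ne_zero⟩
  exact ⟨isPureInjective_zmod _, not_isConeatInjective_zmod_prime_pow p k hp hk⟩
end

section
/- For a left R-module M, the following are equivalent: (1) M is coneat split, i.e. every coneat submodule of M is a direct summand of M; (2) every left R-module N is M-coneat injective; (3) every coneat submodule N of M is M-coneat injective. -/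
/-!
Basic notions from the theory of coneat exact sequences.

A short exact sequence `0 → A → B → C → 0` of left `R`-modules is *coneat exact* if for every
simple right `R`-module `S` the induced map `S ⊗[R] A → S ⊗[R] B` is injective.  Since every
simple right `R`-module is isomorphic to `R ⧸ I` for a maximal right ideal `I` (realized below
as a left ideal `I : Ideal Rᵐᵒᵖ`), and since `(R ⧸ I) ⊗[R] B ≅ B ⧸ I•B` (as abelian groups,
where `I•B` is the additive subgroup generated by the products `i • b`, `i ∈ I`, `b ∈ B`),
this is equivalent to the elementwise condition `A ∩ I•B ⊆ I•A` for every maximal right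
ideal `I`, which is the formulation used here (Mathlib has no tensor product of a right module
with a left module over a noncommutative ring).
-/

universe u v

/-- A coneat submodule `A` of `M` which is `M`-coneat injective is a direct summand of `M`. -/
theorem IsRelConeatInjective.exists_isCompl {R : Type u} [Ring R] {M : Type v} [AddCommGroup M]
    [Module R M] {A : Submodule R M} (hA : IsConeatSubmodule R A)
    (h : IsRelConeatInjective R A M) : ∃ A' : Submodule R M, IsCompl A A' := by
  obtain ⟨g, hg⟩ := h A hA LinearMap.id
  exact ⟨LinearMap.ker g, LinearMap.isCompl_of_proj (LinearMap.congr_fun hg)⟩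

/-- If every coneat submodule of `M` is a direct summand, then every module is `M`-coneat
injective. -/
theorem isRelConeatInjective_of_exists_isCompl {R : Type u} [Ring R] {M : Type v}
    [AddCommGroup M] [Module R M]
    (h : ∀ A : Submodule R M, IsConeatSubmodule R A → ∃ A' : Submodule R M, IsCompl A A')
    (N : Type v) [AddCommGroup N] [Module R N] : IsRelConeatInjective R N M := by
  intro K hK f
  obtain ⟨K', hK'⟩ := h K hK
  refine ⟨f.comp (K.projectionOnto K' hK'), ?_⟩
  rw [LinearMap.comp_assoc, Submodule.projectionOnto_comp_subtype, LinearMap.comp_id]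

/-- For a left `R`-module `M` the following are equivalent: (1) every coneat
submodule of `M` is a direct summand; (2) every left `R`-module `N` is `M`-coneat injective;
(3) every coneat submodule `N` of `M` is `M`-coneat injective. -/
theorem coneat_split_tfae (R : Type u) [Ring R] (M : Type u) [AddCommGroup M] [Module R M] :
    ((∀ A : Submodule R M, IsConeatSubmodule R A → ∃ A' : Submodule R M, IsCompl A A') ↔
      ∀ N : ModuleCat.{u} R, IsRelConeatInjective R N M) ∧
    ((∀ N : ModuleCat.{u} R, IsRelConeatInjective R N M) ↔
      ∀ A : Submodule R M, IsConeatSubmodule R A → IsRelConeatInjective R A M) := by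
  exact ⟨⟨fun h N => isRelConeatInjective_of_exists_isCompl h N,
      fun h A hA => (h (ModuleCat.of R A)).exists_isCompl hA⟩,
    ⟨fun h A _ => h (ModuleCat.of R A),
      fun h N => isRelConeatInjective_of_exists_isCompl (fun A hA => (h A hA).exists_isCompl hA) N⟩⟩
end

section
/- For left R-modules M and B, the following are equivalent: (1) M is B-coneat injective; (2) every exact sequence 0 → M → N (with injection α : M → N) splits whenever there exists an R-homomorphism β : B → N such that α(M) + β(B) = N and β⁻¹(α(M)) is a coneat submodule of B. -/
/-!
Basic notions from the theory of coneat exact sequences.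

A short exact sequence `0 → A → B → C → 0` of left `R`-modules is *coneat exact* if for every
simple right `R`-module `S` the induced map `S ⊗[R] A → S ⊗[R] B` is injective.  Since every
simple right `R`-module is isomorphic to `R ⧸ I` for a maximal right ideal `I` (realized below
as a left ideal `I : Ideal Rᵐᵒᵖ`), and since `(R ⧸ I) ⊗[R] B ≅ B ⧸ I•B` (as abelian groups,
where `I•B` is the additive subgroup generated by the products `i • b`, `i ∈ I`, `b ∈ B`),
this is equivalent to the elementwise condition `A ∩ I•B ⊆ I•A` for every maximal right
ideal `I`, which is the formulation used here (Mathlib has no tensor product of a right module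
with a left module over a noncommutative ring).
-/

universe u v

/-- A linear map vanishing on the kernel of a surjective linear map factors through it. -/
theorem LinearMap.exists_comp_eq_of_ker_le_ker {R P N M : Type*} [Ring R] [AddCommGroup P]
    [Module R P] [AddCommGroup N] [Module R N] [AddCommGroup M] [Module R M] {φ : P →ₗ[R] N}
    {ψ : P →ₗ[R] M} (hφ : Function.Surjective φ) (hker : LinearMap.ker φ ≤ LinearMap.ker ψ) :
    ∃ h : N →ₗ[R] M, h.comp φ = ψ := by
  refine ⟨((LinearMap.ker φ).liftQ ψ hker).comp
    (φ.quotKerEquivOfSurjective hφ).symm.toLinearMap, LinearMap.ext fun x => ?_⟩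
  have hx : (φ.quotKerEquivOfSurjective hφ).symm (φ x) = (LinearMap.ker φ).mkQ x :=
    (LinearEquiv.symm_apply_eq _).2 rfl
  simp [hx]

/-- If the restriction of `β` to `β⁻¹(α(M))`, viewed as a map to `M` along the injection `α`,
extends to all of `B`, then `α` splits. -/
theorem LinearMap.exists_leftInverse_of_extends {R M B N : Type*} [Ring R] [AddCommGroup M]
    [Module R M] [AddCommGroup B] [Module R B] [AddCommGroup N] [Module R N]
    {α : M →ₗ[R] N} {β : B →ₗ[R] N} (hsup : LinearMap.range α ⊔ LinearMap.range β = ⊤)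
    (g : B →ₗ[R] M) (hg : ∀ m b, α m = β b → g b = m) :
    ∃ h : N →ₗ[R] M, h.comp α = LinearMap.id := by
  have hsurj : Function.Surjective (α.coprod β) := by
    rw [← LinearMap.range_eq_top, LinearMap.range_coprod, hsup]
  have hker : LinearMap.ker (α.coprod β) ≤ LinearMap.ker (LinearMap.id.coprod g) := by
    rintro ⟨m, b⟩ hmb
    simp only [LinearMap.mem_ker, LinearMap.coprod_apply, LinearMap.id_apply] at hmb ⊢
    rw [hg (-m) b (by rw [map_neg, neg_eq_of_add_eq_zero_right hmb]), add_neg_cancel]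
  obtain ⟨h, hh⟩ := LinearMap.exists_comp_eq_of_ker_le_ker hsurj hker
  exact ⟨h, LinearMap.ext fun m => by simpa using LinearMap.congr_fun hh (m, 0)⟩

/-- Every homomorphism `f` from a submodule `K` of `B` to `M` has a pushout square
`α ∘ f = β ∘ K.subtype` with `α` injective, `α(M) + β(B) = N` and `β⁻¹(α(M)) = K`. -/
theorem Submodule.exists_pushout {R M B : Type u} [Ring R] [AddCommGroup M] [Module R M]
    [AddCommGroup B] [Module R B] (K : Submodule R B) (f : K →ₗ[R] M) :
    ∃ (N : ModuleCat.{u} R) (α : M →ₗ[R] N) (β : B →ₗ[R] N),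
      Function.Injective α ∧ LinearMap.range α ⊔ LinearMap.range β = ⊤ ∧
        Submodule.comap β (LinearMap.range α) = K ∧ α.comp f = β.comp K.subtype := by
  let W : Submodule R (M × B) := LinearMap.range (f.prod (-K.subtype))
  let α : M →ₗ[R] (M × B) ⧸ W := W.mkQ.comp (LinearMap.inl R M B)
  let β : B →ₗ[R] (M × B) ⧸ W := W.mkQ.comp (LinearMap.inr R M B)
  have heq (m : M) (b : B) : α m = β b ↔ ∃ k : K, f k = m ∧ (k : B) = b := by
    simp only [α, β, LinearMap.comp_apply, Submodule.mkQ_apply, Submodule.Quotient.eq]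
    simp [W]
  refine ⟨ModuleCat.of R ((M × B) ⧸ W), α, β, ?_, ?_, ?_, ?_⟩
  · refine (injective_iff_map_eq_zero α).2 fun m hm => ?_
    obtain ⟨k, rfl, hk⟩ := (heq m 0).1 (by rw [hm, map_zero])
    rw [(Submodule.coe_eq_zero).1 hk, map_zero]
  · rw [← LinearMap.range_coprod, LinearMap.range_eq_top]
    intro x
    obtain ⟨⟨m, b⟩, rfl⟩ := W.mkQ_surjective x
    exact ⟨(m, b), by simp [α, β]⟩
  · ext b
    constructor
    · rintro ⟨m, hm⟩
      obtain ⟨k, -, rfl⟩ := (heq m b).1 hm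
      exact k.2
    · exact fun hb => ⟨f ⟨b, hb⟩, (heq _ _).2 ⟨⟨b, hb⟩, rfl, rfl⟩⟩
  · exact LinearMap.ext fun k => (heq _ _).2 ⟨k, rfl, rfl⟩

/-- `M` is `B`-coneat injective if and only if every exact sequence
`0 → M –α→ N` splits whenever there is a homomorphism `β : B → N` with
`α(M) + β(B) = N` and `β⁻¹(α(M))` a coneat submodule of `B`. -/
theorem relConeatInjective_iff_splitting (R : Type u) [Ring R]
    (M B : Type u) [AddCommGroup M] [Module R M] [AddCommGroup B] [Module R B] :
    IsRelConeatInjective R M B ↔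
      ∀ (N : ModuleCat.{u} R) (α : M →ₗ[R] N) (β : B →ₗ[R] N),
        Function.Injective α →
        LinearMap.range α ⊔ LinearMap.range β = ⊤ →
        IsConeatSubmodule R (Submodule.comap β (LinearMap.range α)) →
        ∃ h : N →ₗ[R] M, h.comp α = LinearMap.id := by
  constructor
  · intro hM N α β hα hsup hK
    obtain ⟨g, hg⟩ := hM _ hK ((LinearEquiv.ofInjective α hα).symm.toLinearMap.comp
      (β.restrict (p := Submodule.comap β (LinearMap.range α)) fun _ hb => hb))
    refine LinearMap.exists_leftInverse_of_extends hsup g fun m b hmb => ?_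
    refine (LinearMap.congr_fun hg ⟨b, m, hmb⟩).trans ?_
    exact (LinearEquiv.symm_apply_eq _).2 (Subtype.ext hmb.symm)
  · intro hsplit K hK f
    obtain ⟨N, α, β, hα, hsup, hcomap, hαβ⟩ := K.exists_pushout f
    obtain ⟨h, hh⟩ := hsplit N α β hα hsup (hcomap.symm ▸ hK)
    exact ⟨h.comp β, by
      rw [LinearMap.comp_assoc, ← hαβ, ← LinearMap.comp_assoc, hh, LinearMap.id_comp]⟩
end

section
/- Let M and N be left R-modules and fix a coneat injective envelope e : M → E of M. Then: (1) if M is coneat-N-injective, then M is coneat-K-injective for every coneat submodule K of N; (2) if M is N-coneat injective, then M is K-coneat injective for every coneat submodule K of N; (3) if M is coneat-N-injective (respectively N-coneat injective), then so is any direct summand of M. -/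
/-!
Basic notions from the theory of coneat exact sequences.

A short exact sequence `0 → A → B → C → 0` of left `R`-modules is *coneat exact* if for every
simple right `R`-module `S` the induced map `S ⊗[R] A → S ⊗[R] B` is injective.  Since every
simple right `R`-module is isomorphic to `R ⧸ I` for a maximal right ideal `I` (realized below
as a left ideal `I : Ideal Rᵐᵒᵖ`), and since `(R ⧸ I) ⊗[R] B ≅ B ⧸ I•B` (as abelian groups,
where `I•B` is the additive subgroup generated by the products `i • b`, `i ∈ I`, `b ∈ B`),
this is equivalent to the elementwise condition `A ∩ I•B ⊆ I•A` for every maximal right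
ideal `I`, which is the formulation used here (Mathlib has no tensor product of a right module
with a left module over a noncommutative ring).
-/

universe u v

theorem map_rIdealSMul {R : Type u} [Ring R] {A B : Type v} [AddCommGroup A] [Module R A]
    [AddCommGroup B] [Module R B] (f : A →ₗ[R] B) (I : Ideal Rᵐᵒᵖ) (S : Set A) :
    (rIdealSMul R I S).map f.toAddMonoidHom = rIdealSMul R I (f '' S) := by
  unfold rIdealSMul
  rw [AddMonoidHom.map_closure]
  congr 1
  ext x
  constructor
  · rintro ⟨_, ⟨i, hi, n, hn, rfl⟩, rfl⟩
    exact ⟨i, hi, f n, ⟨n, hn, rfl⟩, f.map_smul _ _⟩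
  · rintro ⟨i, hi, _, ⟨n, hn, rfl⟩, rfl⟩
    exact ⟨_, ⟨i, hi, n, hn, rfl⟩, f.map_smul _ _⟩

/-- Being a coneat submodule is transitive. -/
theorem IsConeatSubmodule.map_subtype {R : Type u} [Ring R] {B : Type v} [AddCommGroup B]
    [Module R B] {K : Submodule R B} (hK : IsConeatSubmodule R K) {L : Submodule R K}
    (hL : IsConeatSubmodule R L) : IsConeatSubmodule R (L.map K.subtype) := by
  rintro I hI _ ⟨x, hx, rfl⟩ h
  have h₁ := hK I hI _ x.2 h
  have h₂ : (K : Set B) = K.subtype '' Set.univ := by simp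
  rw [h₂, ← map_rIdealSMul] at h₁
  obtain ⟨y, hy, hyx⟩ := h₁
  obtain rfl : y = x := Subtype.ext hyx
  rw [Submodule.map_coe, ← map_rIdealSMul]
  exact ⟨y, hL I hI y hx hy, rfl⟩

theorem IsRelConeatInjective.of_isConeatSubmodule {R : Type u} [Ring R] {M N : Type v}
    [AddCommGroup M] [Module R M] [AddCommGroup N] [Module R N]
    (h : IsRelConeatInjective R M N) {K : Submodule R N} (hK : IsConeatSubmodule R K) :
    IsRelConeatInjective R M K := by
  intro L hL f
  let φ := Submodule.equivMapOfInjective K.subtype K.injective_subtype L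
  obtain ⟨g, hg⟩ := h _ (hK.map_subtype hL) (f.comp φ.symm.toLinearMap)
  refine ⟨g.comp K.subtype, LinearMap.ext fun x => ?_⟩
  simpa [φ] using LinearMap.congr_fun hg (φ x)

theorem IsRelConeatInjective.of_retract {R : Type u} [Ring R] {M N K : Type v}
    [AddCommGroup M] [Module R M] [AddCommGroup N] [Module R N] [AddCommGroup K] [Module R K]
    (h : IsRelConeatInjective R M N) (i : K →ₗ[R] M) (r : M →ₗ[R] K)
    (hri : r.comp i = LinearMap.id) : IsRelConeatInjective R K N := by
  intro L hL f
  obtain ⟨g, hg⟩ := h L hL (i.comp f)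
  exact ⟨r.comp g, by
    rw [LinearMap.comp_assoc, hg, ← LinearMap.comp_assoc, hri, LinearMap.id_comp]⟩

theorem isConeatRelInjective_of_retract {R : Type u} [Ring R] {M N E K : Type v}
    [AddCommGroup M] [Module R M] [AddCommGroup N] [Module R N] [AddCommGroup E] [Module R E]
    [AddCommGroup K] [Module R K] {e : M →ₗ[R] E} (he : IsConeatInjectiveEnvelope R e)
    (h : ∀ f : N →ₗ[R] E, ∀ n : N, f n ∈ LinearMap.range e) (i : K →ₗ[R] M) (r : M →ₗ[R] K)
    (hri : r.comp i = LinearMap.id) : IsConeatRelInjective R K N := by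
  intro E' e' he' f n
  obtain ⟨p, hp⟩ := he'.2.2.1 (ModuleCat.of R E) he.2.1 (e.comp i)
  obtain ⟨q, hq⟩ := he.2.2.1 E' he'.2.1 (e'.comp r)
  have hqp : (q.comp p).comp e' = e' := by
    rw [LinearMap.comp_assoc, hp, ← LinearMap.comp_assoc, hq, LinearMap.comp_assoc, hri,
      LinearMap.comp_id]
  obtain ⟨m, hm⟩ := h (p.comp f) n
  refine ⟨r m, (he'.2.2.2 _ hqp).injective ?_⟩
  calc q.comp p (e' (r m)) = e' (r m) := LinearMap.congr_fun hqp (r m)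
    _ = q (e m) := (LinearMap.congr_fun hq m).symm
    _ = q.comp p (f n) := congrArg q hm

/-- Fix a coneat injective envelope `e : M → E` of `M`. Then: (1) if `M` is
coneat-`N`-injective then `M` is coneat-`K`-injective for every coneat submodule `K ≤ N`;
(2) if `M` is `N`-coneat injective then `M` is `K`-coneat injective for every coneat submodule
`K ≤ N`; (3) if `M` is coneat-`N`-injective (respectively `N`-coneat injective) then so is
every direct summand `K` of `M`. -/
theorem relative_coneat_injectivity_properties (R : Type u) [Ring R]
    (M N E : Type u) [AddCommGroup M] [Module R M] [AddCommGroup N] [Module R N]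
    [AddCommGroup E] [Module R E] (e : M →ₗ[R] E) (he : IsConeatInjectiveEnvelope R e) :
    -- (1)
    ((∀ f : N →ₗ[R] E, ∀ n : N, f n ∈ LinearMap.range e) →
      ∀ K : Submodule R N, IsConeatSubmodule R K →
        ∀ f : K →ₗ[R] E, ∀ x : K, f x ∈ LinearMap.range e) ∧
    -- (2)
    (IsRelConeatInjective R M N →
      ∀ K : Submodule R N, IsConeatSubmodule R K → IsRelConeatInjective R M K) ∧
    -- (3), for the notion coneat-`N`-injective
    ((∀ f : N →ₗ[R] E, ∀ n : N, f n ∈ LinearMap.range e) →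
      ∀ (K : Type u) [AddCommGroup K] [Module R K] (i : K →ₗ[R] M) (r : M →ₗ[R] K),
        r.comp i = LinearMap.id → IsConeatRelInjective R K N) ∧
    -- (3), for the notion `N`-coneat injective
    (IsRelConeatInjective R M N →
      ∀ (K : Type u) [AddCommGroup K] [Module R K] (i : K →ₗ[R] M) (r : M →ₗ[R] K),
        r.comp i = LinearMap.id → IsRelConeatInjective R K N) := by
  refine ⟨fun h K hK f x => ?_, fun h K hK => h.of_isConeatSubmodule hK,
    fun h K _ _ i r hri => isConeatRelInjective_of_retract he h i r hri,
    fun h K _ _ i r hri => h.of_retract i r hri⟩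
  obtain ⟨g, rfl⟩ := he.2.1 (ModuleCat.of R N) K hK f
  exact h g x
end

section
/- Let A be a left R-module and M = ⨁_{i ∈ I} M_i a direct sum of left R-modules. Then A is coneat-M-injective if and only if A is coneat-M_i-injective for each i ∈ I. -/
/-!
Basic notions from the theory of coneat exact sequences.

A short exact sequence `0 → A → B → C → 0` of left `R`-modules is *coneat exact* if for every
simple right `R`-module `S` the induced map `S ⊗[R] A → S ⊗[R] B` is injective.  Since every
simple right `R`-module is isomorphic to `R ⧸ I` for a maximal right ideal `I` (realized below
as a left ideal `I : Ideal Rᵐᵒᵖ`), and since `(R ⧸ I) ⊗[R] B ≅ B ⧸ I•B` (as abelian groups,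
where `I•B` is the additive subgroup generated by the products `i • b`, `i ∈ I`, `b ∈ B`),
this is equivalent to the elementwise condition `A ∩ I•B ⊆ I•A` for every maximal right
ideal `I`, which is the formulation used here (Mathlib has no tensor product of a right module
with a left module over a noncommutative ring).
-/

universe u v

open scoped DirectSum in
/-- `A` is coneat-`⨁ᵢ Mᵢ`-injective if and only if `A` is
coneat-`Mᵢ`-injective for each `i`. -/
theorem coneatRelInjective_directSum_iff (R : Type u) [Ring R]
    (ι : Type u) (M : ι → Type u) [∀ i, AddCommGroup (M i)] [∀ i, Module R (M i)]
    (A : Type u) [AddCommGroup A] [Module R A] :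
    IsConeatRelInjective R A (⨁ i, M i) ↔ ∀ i, IsConeatRelInjective R A (M i) := by
  classical
  refine ⟨fun h i E e he f m ↦ ?_, fun h E e he f x ↦ ?_⟩
  · simpa using h E e he (f.comp (DirectSum.component R ι M i)) (DirectSum.lof R ι M i m)
  · induction x using DirectSum.induction_on with
    | zero => simp
    | of i m => exact h i E e he (f.comp (DirectSum.lof R ι M i)) m
    | add x y hx hy => simpa only [map_add] using add_mem hx hy
end
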